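/- With G(s₁,s₂) = H(s₁+s₂)⁻¹·[E(0,s₁)+E(s₁,s₂)+E(s₁,s₂)E(0,s₁)-E(0,s₁+s₂)], where H(s) has columns (I+E(0,s))·(1,0) and (1,s-2), one has the third-order Taylor expansion at the origin: G(s₁,s₂) = (1/32)·[[4,3],[2,3]]·s₁s₂(s₁+s₂) + o(|(s₁,s₂)|³). In particular all partial derivatives of G of order ≤ 2 vanish at (0,0), and the third-order derivatives ∂³G/∂s₁²∂s₂ and ∂³G/∂s₁∂s₂² at (0,0) both equal (1/16)·[[4,3],[2,3]]. -/

import Mathlib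

open Asymptotics Topology

noncomputable def Emat (v s : ℝ) : Matrix (Fin 2) (Fin 2) ℝ :=
  (4 * s / ((2 * v + s) ^ 2 - 16)) •
    !![s + 4 - 2 * v, 4; (s + 4) * (s - 2) + 4 * v, 3 * s - 4 + 2 * v]

noncomputable def Hmat (s : ℝ) : Matrix (Fin 2) (Fin 2) ℝ :=
  Matrix.of fun i j =>
    if j = 0 then ((1 + Emat 0 s).mulVec ![1, 0]) i else ![1, s - 2] i

noncomputable def Gmat (s₁ s₂ : ℝ) : Matrix (Fin 2) (Fin 2) ℝ :=
  (Hmat (s₁ + s₂))⁻¹ *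
    (Emat 0 s₁ + Emat s₁ s₂ + Emat s₁ s₂ * Emat 0 s₁ - Emat 0 (s₁ + s₂))

noncomputable def Mmat : Matrix (Fin 2) (Fin 2) ℝ := !![4, 3; 2, 3]

open Filter in
/-- `x ↦ x * χ x` has derivative `χ 0` at `0` when `χ` is continuous at `0`. -/
lemma deriv_id_mul (f χ : ℝ → ℝ) (hχ : ContinuousAt χ 0)
    (h : ∀ᶠ x in 𝓝 (0 : ℝ), f x = x * χ x) : deriv f 0 = χ 0 := by
  have h1 : HasDerivAt (fun x => x * χ x) (χ 0) 0 := by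
    rw [hasDerivAt_iff_tendsto_slope]
    have : Tendsto χ (𝓝[≠] 0) (𝓝 (χ 0)) := hχ.tendsto.mono_left nhdsWithin_le_nhds
    refine this.congr' ?_
    filter_upwards [self_mem_nhdsWithin] with x hx
    have hx' : x ≠ 0 := hx
    simp [slope_def_field, hx']
  exact (h1.congr_of_eventuallyEq h).deriv

/-- Second derivative of `x ↦ x * φ x` at `0`. -/
lemma deriv2_id_mul (f φ : ℝ → ℝ) (hφ : ContDiffAt ℝ 2 φ 0)
    (h : ∀ᶠ x in 𝓝 (0 : ℝ), f x = x * φ x) : deriv (deriv f) 0 = 2 * deriv φ 0 := by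
  have hev : ∀ᶠ x in 𝓝 (0 : ℝ), ContDiffAt ℝ 2 φ x := hφ.eventually (by simp)
  have h1 : deriv f =ᶠ[𝓝 0] fun x => φ x + x * deriv φ x := by
    filter_upwards [hev, h.eventually_nhds] with x hx hfx
    have hd : HasDerivAt φ (deriv φ x) x := (hx.differentiableAt (by norm_num)).hasDerivAt
    have := (hasDerivAt_id x).mul hd
    have h2 : HasDerivAt (fun x => x * φ x) (φ x + x * deriv φ x) x := by
      refine HasDerivAt.congr_deriv this ?_
      simp only [id]
      ring
    exact (h2.congr_of_eventuallyEq hfx).deriv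
  rw [h1.deriv_eq]
  have hd : HasDerivAt φ (deriv φ 0) 0 := (hφ.differentiableAt (by norm_num)).hasDerivAt
  have hd1 : ContDiffAt ℝ 1 (deriv φ) 0 := by
    exact hφ.derivWithin (by norm_num)
  have hd2 := (hd1.differentiableAt (by norm_num)).hasDerivAt
  have := hd.add ((hasDerivAt_id (0:ℝ)).mul hd2)
  have h3 : HasDerivAt (fun x => φ x + x * deriv φ x) (2 * deriv φ 0) 0 := by
    refine HasDerivAt.congr_deriv this ?_
    simp only [id]
    ring
  exact h3.deriv

lemma ev_lt : ∀ᶠ x in 𝓝 (0 : ℝ), |x| < 1 := by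
  have : Metric.ball (0:ℝ) 1 ∈ 𝓝 (0:ℝ) := Metric.ball_mem_nhds _ one_pos
  filter_upwards [this] with x hx
  simpa using hx

/-- Partial derivatives, one order of the variables. -/
lemma core_half (g : ℝ → ℝ → ℝ) (W : ℝ × ℝ → ℝ)
    (hW : ∀ p : ℝ × ℝ, |p.1| < 1 → |p.2| < 1 → ContDiffAt ℝ 2 W p)
    (hg : ∀ a b : ℝ, |a| < 1 → |b| < 1 → g a b = a * b * (a + b) * W (a, b)) :
    deriv (fun a => g a 0) 0 = 0 ∧
    deriv (deriv (fun a => g a 0)) 0 = 0 ∧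
    deriv (fun b => deriv (fun a => g a b) 0) 0 = 0 ∧
    deriv (fun b => deriv (deriv (fun a => g a b)) 0) 0 = 2 * W (0, 0) := by
  have h0 : (fun a => g a 0) =ᶠ[𝓝 0] fun _ => (0:ℝ) := by
    filter_upwards [ev_lt] with a ha
    rw [hg a 0 ha (by simp)]; ring
  have hWs : ∀ b : ℝ, |b| < 1 → ContDiffAt ℝ 2 (fun a => W (a, b)) 0 := by
    intro b hb
    exact ContDiffAt.comp (0:ℝ) (f := fun a : ℝ => (a, b)) (hW (0, b) (by simp) hb)
      (contDiffAt_id.prodMk contDiffAt_const)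
  have hφ : ∀ b : ℝ, |b| < 1 → ContDiffAt ℝ 2 (fun a => b * (a + b) * W (a, b)) 0 := by
    intro b hb
    exact (contDiffAt_const.mul (contDiffAt_id.add contDiffAt_const)).mul (hWs b hb)
  have hge : ∀ b : ℝ, |b| < 1 →
      ∀ᶠ a in 𝓝 (0:ℝ), g a b = a * (b * (a + b) * W (a, b)) := by
    intro b hb
    filter_upwards [ev_lt] with a ha
    rw [hg a b ha hb]; ring
  have hWc : ContinuousAt (fun b : ℝ => W (0, b)) 0 := by
    exact ContinuousAt.comp (x := (0:ℝ)) (f := fun b : ℝ => ((0:ℝ), b))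
      (hW (0, 0) (by simp) (by simp)).continuousAt (by fun_prop)
  have hFc : ContinuousAt (fun b : ℝ => fderiv ℝ W (0, b) (1, 0)) 0 := by
    have h1 : ContinuousAt (fderiv ℝ W) ((0:ℝ), (0:ℝ)) :=
      ((hW (0, 0) (by simp) (by simp)).fderiv_right (m := 1) (by norm_num)).continuousAt
    have h2 : ContinuousAt (fun b : ℝ => fderiv ℝ W (0, b)) 0 :=
      ContinuousAt.comp (x := (0:ℝ)) (f := fun b : ℝ => ((0:ℝ), b)) h1 (by fun_prop)
    exact h2.clm_apply continuousAt_const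
  have hWd : ∀ b : ℝ, |b| < 1 →
      HasDerivAt (fun a => W (a, b)) (fderiv ℝ W (0, b) (1, 0)) 0 := by
    intro b hb
    have h1 := ((hW (0, b) (by simp) hb).differentiableAt (by norm_num)).hasFDerivAt
    exact h1.comp_hasDerivAt (f := fun a : ℝ => (a, b)) (0:ℝ)
      ((hasDerivAt_id (0:ℝ)).prodMk (hasDerivAt_const (0:ℝ) b))
  refine ⟨?_, ?_, ?_, ?_⟩
  · rw [h0.deriv_eq]; simp
  · rw [h0.deriv.deriv_eq]; simp
  · rw [deriv_id_mul _ (fun b => b * W (0, b)) (continuousAt_id.mul hWc)]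
    · simp
    · filter_upwards [ev_lt] with b hb
      rw [deriv_id_mul _ _ (hφ b hb).continuousAt (hge b hb)]
      ring
  · rw [deriv_id_mul _ (fun b => 2 * (W (0, b) + b * fderiv ℝ W (0, b) (1, 0)))
        (continuousAt_const.mul (hWc.add (continuousAt_id.mul hFc)))]
    · simp
    · filter_upwards [ev_lt] with b hb
      rw [deriv2_id_mul _ _ (hφ b hb) (hge b hb)]
      have h1 : HasDerivAt (fun a : ℝ => b * (a + b)) b 0 := by
        simpa using ((hasDerivAt_id (0:ℝ)).add_const b).const_mul b
      have h2 : HasDerivAt (fun a : ℝ => b * (a + b) * W (a, b)) _ 0 := h1.mul (hWd b hb)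
      rw [h2.deriv]
      ring

lemma core (g : ℝ → ℝ → ℝ) (W : ℝ × ℝ → ℝ) (m : ℝ)
    (hW : ∀ p : ℝ × ℝ, |p.1| < 1 → |p.2| < 1 → ContDiffAt ℝ 2 W p)
    (hg : ∀ a b : ℝ, |a| < 1 → |b| < 1 → g a b = a * b * (a + b) * W (a, b))
    (hm : W (0, 0) = m / 32) :
    ((fun p : ℝ × ℝ => g p.1 p.2 - p.1 * p.2 * (p.1 + p.2) / 32 * m)
          =o[𝓝 (0 : ℝ × ℝ)] fun p => ‖p‖ ^ 3) ∧
    (g 0 0 = 0 ∧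
      deriv (fun s₁ => g s₁ 0) 0 = 0 ∧
      deriv (fun s₂ => g 0 s₂) 0 = 0 ∧
      deriv (deriv (fun s₁ => g s₁ 0)) 0 = 0 ∧
      deriv (deriv (fun s₂ => g 0 s₂)) 0 = 0 ∧
      deriv (fun s₂ => deriv (fun s₁ => g s₁ s₂) 0) 0 = 0 ∧
      deriv (fun s₂ => deriv (deriv (fun s₁ => g s₁ s₂)) 0) 0 = (1 / 16) * m ∧
      deriv (fun s₁ => deriv (deriv (fun s₂ => g s₁ s₂)) 0) 0 = (1 / 16) * m) := by
  obtain ⟨a1, a2, a3, a4⟩ := core_half g W hW hg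
  obtain ⟨b1, b2, b3, b4⟩ := core_half (fun a b => g b a) (fun p => W (p.2, p.1))
    (fun p h1 h2 => ContDiffAt.comp p (f := fun p : ℝ × ℝ => (p.2, p.1)) (hW (p.2, p.1) h2 h1)
      (contDiffAt_snd.prodMk contDiffAt_fst))
    (fun a b h1 h2 => by rw [hg b a h2 h1]; ring)
  refine ⟨?_, ?_, a1, b1, a2, b2, a3, ?_, ?_⟩
  · have hev : (fun p : ℝ × ℝ => g p.1 p.2 - p.1 * p.2 * (p.1 + p.2) / 32 * m)
        =ᶠ[𝓝 (0 : ℝ × ℝ)] fun p => (p.1 * p.2 * (p.1 + p.2)) * (W p - W (0, 0)) := by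
      have : Metric.ball (0:ℝ × ℝ) 1 ∈ 𝓝 (0:ℝ × ℝ) := Metric.ball_mem_nhds _ one_pos
      filter_upwards [this] with p hp
      have hp' : ‖p‖ < 1 := by simpa using hp
      rw [hg p.1 p.2 ((norm_fst_le p).trans_lt hp') ((norm_snd_le p).trans_lt hp'), hm]
      ring
    refine hev.trans_isLittleO ?_
    have h1 : (fun p : ℝ × ℝ => p.1 * p.2 * (p.1 + p.2)) =O[𝓝 (0 : ℝ × ℝ)]
        fun p => ‖p‖ ^ 3 := by
      refine IsBigO.of_bound 2 (Filter.Eventually.of_forall fun p => ?_)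
      have e1 := norm_fst_le p
      have e2 := norm_snd_le p
      have e3 : ‖p.1 + p.2‖ ≤ 2 * ‖p‖ := (norm_add_le _ _).trans (by linarith)
      rw [norm_mul, norm_mul, norm_pow, norm_norm]
      calc ‖p.1‖ * ‖p.2‖ * ‖p.1 + p.2‖ ≤ ‖p‖ * ‖p‖ * (2 * ‖p‖) := by gcongr
        _ = 2 * ‖p‖ ^ 3 := by ring
    have h2 : (fun p : ℝ × ℝ => W p - W (0, 0)) =o[𝓝 (0 : ℝ × ℝ)] fun _ => (1:ℝ) := by
      rw [isLittleO_one_iff]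
      have := (hW (0, 0) (by simp) (by simp)).continuousAt.tendsto
      have h3 := this.sub_const (W (0, 0))
      rw [sub_self] at h3
      exact h3
    simpa using h1.mul_isLittleO h2
  · rw [hg 0 0 (by simp) (by simp)]; ring
  · rw [a4, hm]; ring
  · have : (2:ℝ) * W (0, 0) = 1 / 16 * m := by rw [hm]; ring
    rw [← this]; exact b4

/-- The quotient of `G` by `s₁ s₂ (s₁ + s₂)`. -/
noncomputable def Wfun (i j : Fin 2) (p : ℝ × ℝ) : ℝ :=
  !![4 / ((p.1 + p.2 - 2) * (p.1 - 4) * (2 * p.1 + p.2 + 4)),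
     (48 + 16 * p.2 + 20 * p.1) / ((p.1 + p.2 - 2) * (p.1 + p.2 + 4) * (p.1 - 4) * (p.1 + 4)
        * (2 * p.1 + p.2 + 4));
     (32 + 8 * p.2 + 16 * p.1 - 16 * p.1 * p.2 - 16 * p.1 ^ 2) /
        ((p.1 + p.2 - 2) * (p.1 + p.2 - 4) * (p.1 - 4) * (2 * p.1 + p.2 - 4)
          * (2 * p.1 + p.2 + 4)),
     (192 - 16 * p.2 + 16 * p.1 - 52 * p.1 * p.2 - 56 * p.1 ^ 2) /
        ((p.1 + p.2 - 2) * (p.1 + p.2 - 4) * (p.1 - 4) * (p.1 + 4) * (2 * p.1 + p.2 - 4)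
          * (2 * p.1 + p.2 + 4))] i j

lemma nz (a b : ℝ) (ha : |a| < 1) (hb : |b| < 1) :
    a + b - 2 ≠ 0 ∧ a + b - 4 ≠ 0 ∧ a + b + 4 ≠ 0 ∧ a - 4 ≠ 0 ∧ a + 4 ≠ 0 ∧
    2 * a + b - 4 ≠ 0 ∧ 2 * a + b + 4 ≠ 0 := by
  rw [abs_lt] at ha hb
  obtain ⟨h1, h2⟩ := ha
  obtain ⟨h3, h4⟩ := hb
  refine ⟨?_, ?_, ?_, ?_, ?_, ?_, ?_⟩ <;> intro h <;> linarith

lemma Wfun_contDiff (i j : Fin 2) (p : ℝ × ℝ) (ha : |p.1| < 1) (hb : |p.2| < 1) :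
    ContDiffAt ℝ 2 (Wfun i j) p := by
  obtain ⟨h1, h2, h3, h4, h5, h6, h7⟩ := nz p.1 p.2 ha hb
  fin_cases i <;> fin_cases j <;> simp [Wfun] <;>
    refine ContDiffAt.div (by fun_prop) (by fun_prop) (by simp [*])

lemma Emat_eq (v s : ℝ) : Emat v s =
    !![4 * s * (s + 4 - 2 * v) / ((2 * v + s - 4) * (2 * v + s + 4)),
       4 * s * 4 / ((2 * v + s - 4) * (2 * v + s + 4));
       4 * s * ((s + 4) * (s - 2) + 4 * v) / ((2 * v + s - 4) * (2 * v + s + 4)),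
       4 * s * (3 * s - 4 + 2 * v) / ((2 * v + s - 4) * (2 * v + s + 4))] := by
  have : (2 * v + s) ^ 2 - 16 = (2 * v + s - 4) * (2 * v + s + 4) := by ring
  ext i j
  fin_cases i <;> fin_cases j <;> simp [Emat, this] <;> ring

lemma Hinv (s : ℝ) (h2 : s - 2 ≠ 0) (h4 : s - 4 ≠ 0) (h4' : s + 4 ≠ 0) :
    (Hmat s)⁻¹ = !![1, -1 / (s - 2);
      -4 * s / (s - 4), (5 * s - 4) / ((s - 4) * (s - 2))] := by
  apply Matrix.inv_eq_left_inv
  ext i j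
  fin_cases i <;> fin_cases j <;>
    simp [Hmat, Emat_eq, Matrix.mul_apply, Fin.sum_univ_two, Matrix.mulVec, dotProduct] <;>
    field_simp <;> ring

lemma Gmat_eq (i j : Fin 2) (a b : ℝ) (ha : |a| < 1) (hb : |b| < 1) :
    Gmat a b i j = a * b * (a + b) * Wfun i j (a, b) := by
  obtain ⟨h1, h2, h3, h4, h5, h6, h7⟩ := nz a b ha hb
  have h6' : a * 2 + b - 4 ≠ 0 := by rwa [mul_comm a 2]
  have h7' : a * 2 + b + 4 ≠ 0 := by rwa [mul_comm a 2]
  rw [Gmat, Hinv _ h1 h2 h3]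
  simp only [Emat_eq]
  fin_cases i <;> fin_cases j <;>
    simp [Wfun, Matrix.mul_apply, Fin.sum_univ_two] <;>
    field_simp <;> ring

theorem stmt11 :
    (∀ i j, (fun p : ℝ × ℝ =>
        Gmat p.1 p.2 i j - p.1 * p.2 * (p.1 + p.2) / 32 * Mmat i j)
          =o[𝓝 (0 : ℝ × ℝ)] fun p => ‖p‖ ^ 3) ∧
    (∀ i j,
      Gmat 0 0 i j = 0 ∧
      deriv (fun s₁ => Gmat s₁ 0 i j) 0 = 0 ∧
      deriv (fun s₂ => Gmat 0 s₂ i j) 0 = 0 ∧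
      deriv (deriv (fun s₁ => Gmat s₁ 0 i j)) 0 = 0 ∧
      deriv (deriv (fun s₂ => Gmat 0 s₂ i j)) 0 = 0 ∧
      deriv (fun s₂ => deriv (fun s₁ => Gmat s₁ s₂ i j) 0) 0 = 0 ∧
      deriv (fun s₂ => deriv (deriv (fun s₁ => Gmat s₁ s₂ i j)) 0) 0 =
        (1 / 16) * Mmat i j ∧
      deriv (fun s₁ => deriv (deriv (fun s₂ => Gmat s₁ s₂ i j)) 0) 0 =
        (1 / 16) * Mmat i j) := by
  have key := fun i j : Fin 2 => core (fun a b => Gmat a b i j) (Wfun i j) (Mmat i j)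
    (Wfun_contDiff i j) (Gmat_eq i j)
    (by fin_cases i <;> fin_cases j <;> simp [Wfun, Mmat] <;> norm_num)
  exact ⟨fun i j => (key i j).1, fun i j => (key i j).2⟩
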